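/- arXiv:2405.04823 — 2 statements merged into one kernel-verified Lean document; each statement's English description precedes it below -/
import Mathlib

section
/- Let G be a finite simple graph, let R and C be disjoint finite vertex sets, and let u be a vertex of C such that R ∪ {u} is an s-plex. Define ω_p(u, R, C) as the largest integer k such that there exists a subset S ⊆ N(u) ∩ C with |S| = k and Σ_{v ∈ S} m̄(v, R) ≤ Σ_{w ∈ R} (s − m̄(w, R)), and define γ_p(u, R, C) = |R ∪ {u}| + ω_p(u, R, C) + min{s − m̄(u, R), m̄(u, C)}, where m̄(u, C) = |C| − |N(u) ∩ C|. Then every s-plex Q of G with R ∪ {u} ⊆ Q ⊆ R ∪ {u} ∪ C satisfies |Q| ≤ γ_p(u, R, C). -/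
open Finset

variable {V : Type*} [Fintype V] [DecidableEq V]

/-- `E(Q)`: the edges of `G` with both endpoints in `Q`. -/
def edgesIn (G : SimpleGraph V) [DecidableRel G.Adj] (Q : Finset V) : Finset (Sym2 V) :=
  G.edgeFinset ∩ Q.sym2

/-- `m̄(Q) = C(|Q|,2) - |E(Q)|`: the number of missing edges of `Q`. -/
def mbar (G : SimpleGraph V) [DecidableRel G.Adj] (Q : Finset V) : ℕ :=
  Q.card.choose 2 - (edgesIn G Q).card

/-- `m̄(u,Q) = |Q \ {u}| - |N(u) ∩ Q|`: the number of non-neighbors of `u` in `Q \ {u}`. -/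
def mbarV (G : SimpleGraph V) [DecidableRel G.Adj] (u : V) (Q : Finset V) : ℕ :=
  (Q.erase u).card - (Q.filter (fun v => G.Adj u v)).card

theorem mbarV_eq_card_filter {W : Type*} [DecidableEq W] (G : SimpleGraph W)
    [DecidableRel G.Adj] (u : W) (Q : Finset W) :
    mbarV G u Q = #{v ∈ Q | v ≠ u ∧ ¬ G.Adj u v} := by
  have hN : Q.filter (fun v => G.Adj u v) ⊆ Q.erase u := fun v hv => by
    rw [mem_filter] at hv
    exact mem_erase.2 ⟨hv.2.ne', hv.1⟩
  rw [mbarV, ← card_sdiff_of_subset hN]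
  congr 1
  ext v
  simp only [mem_sdiff, mem_erase, mem_filter]
  tauto

theorem mbarV_mono {W : Type*} [DecidableEq W] (G : SimpleGraph W) [DecidableRel G.Adj]
    (u : W) {P Q : Finset W} (h : P ⊆ Q) : mbarV G u P ≤ mbarV G u Q := by
  simp only [mbarV_eq_card_filter]
  exact card_le_card (filter_subset_filter _ h)

theorem mbarV_union_of_disjoint {W : Type*} [DecidableEq W] (G : SimpleGraph W)
    [DecidableRel G.Adj] (u : W) {P Q : Finset W} (h : Disjoint P Q) :
    mbarV G u (P ∪ Q) = mbarV G u P + mbarV G u Q := by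
  simp only [mbarV_eq_card_filter, filter_union]
  exact card_union_of_disjoint (disjoint_filter_filter h)

theorem sum_mbarV_comm {W : Type*} [DecidableEq W] (G : SimpleGraph W) [DecidableRel G.Adj]
    (P Q : Finset W) :
    ∑ v ∈ P, mbarV G v Q = ∑ w ∈ Q, mbarV G w P := by
  simp only [mbarV_eq_card_filter, card_filter]
  rw [sum_comm]
  simp only [ne_comm, G.adj_comm]

theorem plex_size_upper_bound (G : SimpleGraph V) [DecidableRel G.Adj]
    (s : ℕ) (R C : Finset V) (u : V) (hdisj : Disjoint R C) (hu : u ∈ C)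
    (hRu : ∀ w ∈ insert u R, mbarV G w (insert u R) ≤ s) (ω : ℕ)
    (hω : IsGreatest {k : ℕ | ∃ S ⊆ C.filter (fun v => G.Adj u v), S.card = k ∧
      (∑ v ∈ S, (mbarV G v R : ℤ)) ≤ ∑ w ∈ R, ((s : ℤ) - mbarV G w R)} ω)
    (Q : Finset V) (hQ : ∀ w ∈ Q, mbarV G w Q ≤ s)
    (h1 : insert u R ⊆ Q) (h2 : Q ⊆ insert u (R ∪ C)) :
    Q.card ≤ (insert u R).card + ω + min (s - mbarV G u R) (mbarV G u C) := by
  have hRQ : R ⊆ Q := (subset_insert u R).trans h1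
  have huQ : u ∈ Q := h1 (mem_insert_self u R)
  set S := {v ∈ Q ∩ C | G.Adj u v} with hS
  set T := {v ∈ Q ∩ C | v ≠ u ∧ ¬ G.Adj u v} with hT
  have hSQ : S ⊆ Q := (filter_subset _ _).trans inter_subset_left
  have hRS : Disjoint R S := hdisj.mono_right ((filter_subset _ _).trans inter_subset_right)
  have hSω : #S ≤ ω := by
    refine hω.2 ⟨S, filter_subset_filter _ inter_subset_right, rfl, ?_⟩
    have hcomm : (∑ v ∈ S, (mbarV G v R : ℤ)) = ∑ w ∈ R, (mbarV G w S : ℤ) :=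
      mod_cast sum_mbarV_comm G S R
    rw [hcomm]
    refine sum_le_sum fun w hw => ?_
    have hunion := mbarV_union_of_disjoint G w hRS
    have hle := (mbarV_mono G w (union_subset hRQ hSQ)).trans (hQ w (hRQ hw))
    lia
  have hTcard : #T = mbarV G u (Q ∩ C) := (mbarV_eq_card_filter G u _).symm
  have hTC : #T ≤ mbarV G u C := hTcard ▸ mbarV_mono G u inter_subset_right
  have hTs : #T ≤ s - mbarV G u R := by
    have hunion := mbarV_union_of_disjoint G u (hdisj.mono_right (inter_subset_right (s₁ := Q)))
    have hle := (mbarV_mono G u (union_subset hRQ (inter_subset_left (s₂ := C)))).trans (hQ u huQ)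
    lia
  have hcover : Q ⊆ insert u R ∪ S ∪ T := fun v hv => by
    have hv' := h2 hv
    simp only [hS, hT, mem_union, mem_insert, mem_filter, mem_inter] at hv' ⊢
    tauto
  calc #Q ≤ #(insert u R ∪ S ∪ T) := card_le_card hcover
    _ ≤ #(insert u R) + #S + #T :=
      (card_union_le _ _).trans (Nat.add_le_add_right (card_union_le _ _) _)
    _ ≤ _ := Nat.add_le_add (Nat.add_le_add_left hSω _) (le_min hTs hTC)
end

section
/- Let G be a finite simple graph, let R and C be disjoint finite vertex sets, let u ∈ C be a vertex such that R ∪ {u} is an s-plex, and set C₁ = N(u) ∩ C. Suppose that every vertex v ∈ R \ N(u) satisfies m̄(v, R ∪ C₁) ≤ s − 1. Then u is a pivot vertex: for every subset H ⊆ C₁ such that R ∪ H is an s-plex, the set R ∪ H ∪ {u} is also an s-plex. -/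
open Finset

variable {V : Type*} [Fintype V] [DecidableEq V]

theorem mbarV_eq_card_filter_s13 (G : SimpleGraph V) [DecidableRel G.Adj] (w : V) (Q : Finset V) :
    mbarV G w Q = (Q.filter (fun v => v ≠ w ∧ ¬ G.Adj w v)).card := by
  have hsub : Q.filter (fun v => G.Adj w v) ⊆ Q.erase w := fun v hv => by
    rw [mem_filter] at hv
    exact mem_erase.2 ⟨hv.2.ne', hv.1⟩
  rw [mbarV, ← card_sdiff_of_subset hsub]
  congr 1
  ext v
  simp only [mem_sdiff, mem_erase, mem_filter]
  tauto

theorem mbarV_le_of_forall_nonadj_mem (G : SimpleGraph V) [DecidableRel G.Adj] (w : V)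
    {P Q : Finset V} (h : ∀ v ∈ P, ¬ G.Adj w v → v ∈ Q) : mbarV G w P ≤ mbarV G w Q := by
  simp only [mbarV_eq_card_filter_s13]
  refine card_le_card fun v hv => ?_
  rw [mem_filter] at hv ⊢
  exact ⟨h v hv.1 hv.2.2, hv.2⟩

theorem mbarV_insert_le (G : SimpleGraph V) [DecidableRel G.Adj] (w u : V) (Q : Finset V) :
    mbarV G w (insert u Q) ≤ mbarV G w Q + 1 := by
  simp only [mbarV_eq_card_filter_s13, filter_insert]
  split_ifs
  · exact card_insert_le _ _
  · exact Nat.le_succ _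

theorem plex_pivot_refined (G : SimpleGraph V) [DecidableRel G.Adj]
    (s : ℕ) (R C : Finset V) (u : V) (hdisj : Disjoint R C) (hu : u ∈ C)
    (hRu : ∀ w ∈ insert u R, mbarV G w (insert u R) ≤ s)
    (C₁ : Finset V) (hC₁ : C₁ = C.filter (fun v => G.Adj u v))
    (hcond : ∀ v ∈ R, ¬ G.Adj u v → mbarV G v (R ∪ C₁) + 1 ≤ s) :
    ∀ H ⊆ C₁, (∀ w ∈ R ∪ H, mbarV G w (R ∪ H) ≤ s) →
      ∀ w ∈ insert u (R ∪ H), mbarV G w (insert u (R ∪ H)) ≤ s := by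
  intro H hH hRH w hw
  have hadj : ∀ v ∈ H, G.Adj u v := fun v hv => by
    have := hH hv
    rw [hC₁, mem_filter] at this
    exact this.2
  obtain rfl | hw := mem_insert.1 hw
  · refine (mbarV_le_of_forall_nonadj_mem G w fun v hv hnadj => ?_).trans
      (hRu w (mem_insert_self w R))
    rw [mem_insert, mem_union] at hv
    rw [mem_insert]
    exact hv.imp_right fun hv => hv.resolve_right fun hvH => hnadj (hadj v hvH)
  · by_cases huw : G.Adj u w
    · refine (mbarV_le_of_forall_nonadj_mem G w fun v hv hnadj => ?_).trans (hRH w hw)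
      exact (mem_insert.1 hv).resolve_left fun hvu => hnadj (hvu ▸ huw.symm)
    · have hwR : w ∈ R := (mem_union.1 hw).resolve_right fun hwH => huw (hadj w hwH)
      calc mbarV G w (insert u (R ∪ H)) ≤ mbarV G w (R ∪ H) + 1 := mbarV_insert_le G w u _
        _ ≤ mbarV G w (R ∪ C₁) + 1 := Nat.add_le_add_right
            (mbarV_le_of_forall_nonadj_mem G w fun v hv _ => union_subset_union_right hH hv) 1
        _ ≤ s := hcond w hwR huw
end
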